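/- arXiv:math/0506227 — 4 statements merged into one kernel-verified Lean document; each statement's English description precedes it below -/
import Mathlib

section
/- Let ζ be a nonnegative random variable with cumulative distribution function F and finite mean E ζ = 1/μ (μ > 0). If sup_{x≥0, y≥0} |F_y(x) − F(x)| < ε for some ε > 0, then sup_{x≥0} |F(x) − (1 − e^{−μx})| < 2ε; that is, the Kolmogorov distance between F and the exponential distribution E_μ is less than 2ε. -/
open MeasureTheory Real Set

/-- The conditional distribution function `F_y(x) = Pr{ζ ≤ x + y | ζ > y}
= (F(x+y) - F(y)) / (1 - F(y))`, with the convention `0/0 = 0`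
(which is automatic for real division in Lean). -/
noncomputable def condF (F : ℝ → ℝ) (y x : ℝ) : ℝ := (F (x + y) - F y) / (1 - F y)

/-- An antitone function on the half line whose translates are, up to a relative error `δ`,
multiples of itself satisfies an integral equation up to the error `δ`. -/
lemma abs_integral_sub_le_of_almost_multiplicative {G : ℝ → ℝ} {μ δ : ℝ} (hμ : 0 < μ)
    (hint : IntegrableOn G (Ioi 0)) (hmean : ∫ y in Ioi 0, G y = 1 / μ)
    (hG : ∀ x ≥ 0, ∀ y ≥ 0, |G (x + y) - G x * G y| ≤ δ * G y) {x : ℝ} (hx : 0 ≤ x) :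
    |1 - μ * (∫ y in (0 : ℝ)..x, G y) - G x| ≤ δ := by
  have hmp := measurePreserving_add_left (volume : Measure ℝ) x
  have hemb := measurableEmbedding_addLeft x
  have hpre : (fun y => x + y) ⁻¹' Ioi x = Ioi 0 := by ext; simp
  have hintx : IntegrableOn G (Ioi x) := hint.mono_set (Ioi_subset_Ioi hx)
  have hshift : IntegrableOn (fun y => G (x + y)) (Ioi 0) := by
    rw [← hpre]
    exact (hmp.integrableOn_comp_preimage hemb).2 hintx
  have hshift_eq : ∫ y in Ioi 0, G (x + y) = ∫ y in Ioi x, G y := by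
    rw [← hpre]
    exact hmp.setIntegral_preimage_emb hemb G (Ioi x)
  have hsplit := intervalIntegral.integral_interval_add_Ioi hint hintx
  have hbound : |∫ y in Ioi 0, (G (x + y) - G x * G y)| ≤ ∫ y in Ioi 0, δ * G y := by
    refine abs_integral_le_integral_abs.trans (setIntegral_mono_on
      (hshift.sub (hint.const_mul _)).abs (hint.const_mul _) measurableSet_Ioi ?_)
    exact fun y hy => hG x hx y (le_of_lt hy)
  rw [integral_sub hshift (hint.const_mul _), integral_const_mul, integral_const_mul, hshift_eq,
    eq_sub_of_add_eq' hsplit, hmean] at hbound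
  calc |1 - μ * (∫ y in (0 : ℝ)..x, G y) - G x|
      = μ * |1 / μ - (∫ y in (0 : ℝ)..x, G y) - G x * (1 / μ)| := by
        rw [← abs_of_pos hμ, ← abs_mul, abs_of_pos hμ]
        congr 1
        field_simp
    _ ≤ μ * (δ * (1 / μ)) := by gcongr
    _ = δ := by field_simp

/-- Stability of the integral equation `G x = 1 - μ ∫₀ˣ G` of the exponential function. -/
lemma abs_sub_exp_le_of_abs_integral_sub_le {G : ℝ → ℝ} {μ δ : ℝ} (hμ : 0 < μ)
    (hint : ∀ x, IntervalIntegrable G volume 0 x)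
    (hmeas : StronglyMeasurable G)
    (hcont : ∀ x, ContinuousWithinAt G (Ici x) x)
    (hG : ∀ x ≥ 0, |1 - μ * (∫ y in (0 : ℝ)..x, G y) - G x| ≤ δ) {x : ℝ} (hx : 0 ≤ x) :
    |G x - exp (-μ * x)| ≤ 2 * δ := by
  set H : ℝ → ℝ := fun x => 1 - μ * ∫ y in (0 : ℝ)..x, G y with hH
  have hE (t : ℝ) : HasDerivAt (fun t => exp (μ * t)) (exp (μ * t) * μ) t := by
    simpa using ((hasDerivAt_id t).const_mul μ).exp
  have hHd (t : ℝ) : HasDerivWithinAt H (-(μ * G t)) (Ici t) t :=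
    ((intervalIntegral.integral_hasDerivWithinAt_right (hint t) (s := Ici t) (t := Ioi t)
      hmeas.stronglyMeasurableAtFilter
      ((hcont t).mono Ioi_subset_Ici_self)).const_mul μ).const_sub 1
  have hHc : Continuous H := continuous_const.sub (continuous_const.mul
    (intervalIntegral.continuous_primitive
      (fun a b => (hint a).symm.trans (hint b)) 0))
  have hδ : 0 ≤ δ := (abs_nonneg _).trans (hG 0 le_rfl)
  have key := image_norm_le_of_norm_deriv_right_le_deriv_boundary (a := 0) (b := x)
    (f := fun t => exp (μ * t) * H t - 1)
    (f' := fun t => exp (μ * t) * μ * H t + exp (μ * t) * (-(μ * G t)))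
    (B := fun t => δ * (exp (μ * t) - 1)) (B' := fun t => δ * (exp (μ * t) * μ))
    (by fun_prop)
    (fun t _ => ((hE t).hasDerivWithinAt.mul (hHd t)).sub_const 1)
    (by simp [hH])
    (fun t => ((hE t).sub_const 1).const_mul δ)
    (fun t ht => by
      have h := hG t ht.1
      have hpos : 0 < exp (μ * t) * μ := by positivity
      rw [Real.norm_eq_abs, show exp (μ * t) * μ * H t + exp (μ * t) * (-(μ * G t))
        = exp (μ * t) * μ * (H t - G t) by ring, abs_mul, abs_of_pos hpos, mul_comm δ]
      gcongr)
    (right_mem_Icc.2 hx)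
  have hexp : exp (-μ * x) * exp (μ * x) = 1 := by rw [← exp_add]; simp
  have hHexp : |H x - exp (-μ * x)| ≤ δ := by
    have hpos := exp_pos (-μ * x)
    calc |H x - exp (-μ * x)| = exp (-μ * x) * |exp (μ * x) * H x - 1| := by
          rw [← abs_of_pos hpos, ← abs_mul, abs_of_pos hpos]
          congr 1
          linear_combination (-H x) * hexp
      _ ≤ exp (-μ * x) * (δ * (exp (μ * x) - 1)) := by gcongr; exact key
      _ ≤ δ := by nlinarith [mul_nonneg hδ hpos.le]
  have h := hG x hx
  rw [abs_le] at h hHexp ⊢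
  constructor <;> linarith [h.1, h.2, hHexp.1, hHexp.2]

/-- **Azlarov–Volodin characterization.**  If `ζ` is a nonnegative random variable
(with law `ν`) with distribution function `F` and finite mean `1/μ`, and
`sup_{x≥0, y≥0} |F_y(x) - F(x)| < ε`, then the Kolmogorov distance between `F` and
the exponential distribution `E_μ` is less than `2ε`. -/
theorem azlarov_volodin_characterization
    (μ ε : ℝ) (hμ : 0 < μ) (hε : 0 < ε)
    (ν : Measure ℝ) [IsProbabilityMeasure ν] (hν : ν (Set.Iio 0) = 0)
    (F : ℝ → ℝ) (hF : ∀ x, F x = (ν (Set.Iic x)).toReal)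
    (hint : Integrable (fun x => x) ν)
    (hmean : ∫ x, x ∂ν = 1 / μ)
    (hsup : sSup {d : ℝ | ∃ x ≥ (0:ℝ), ∃ y ≥ (0:ℝ), d = |condF F y x - F x|} < ε) :
    sSup {d : ℝ | ∃ x ≥ (0:ℝ), d = |F x - (1 - Real.exp (-μ * x))|} < 2 * ε := by
  have hcdf : F = ProbabilityTheory.cdf ν := by
    ext x
    rw [hF, ProbabilityTheory.cdf_eq_real, measureReal_def]
  have hmono : Monotone F := hcdf ▸ ProbabilityTheory.monotone_cdf ν
  have hF0 (x : ℝ) : 0 ≤ F x := hcdf ▸ ProbabilityTheory.cdf_nonneg ν x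
  have hF1 (x : ℝ) : F x ≤ 1 := hcdf ▸ ProbabilityTheory.cdf_le_one ν x
  set G : ℝ → ℝ := fun x => 1 - F x
  have hGanti : Antitone G := fun _ _ h => sub_le_sub_left (hmono h) 1
  have hGcont (x : ℝ) : ContinuousWithinAt G (Ici x) x := by
    refine continuousWithinAt_const.sub ?_
    rw [hcdf]
    exact (ProbabilityTheory.cdf ν).right_continuous x
  have hnn : 0 ≤ᵐ[ν] fun x => x := by
    rw [Filter.EventuallyLE, ae_iff]
    convert hν using 2
    ext
    simp
  have hGmean : ∫ y in Ioi 0, G y = 1 / μ := by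
    rw [← hmean, hint.integral_eq_integral_meas_lt hnn]
    congr 1
    ext t
    change 1 - F t = ν.real (Ioi t)
    rw [hF, ← compl_Iic, probReal_compl_eq_one_sub measurableSet_Iic, measureReal_def]
  have hGint : IntegrableOn G (Ioi 0) := by
    by_contra h
    rw [integral_undef h] at hGmean
    exact (one_div_pos.2 hμ).ne hGmean
  set δ := sSup {d : ℝ | ∃ x ≥ (0:ℝ), ∃ y ≥ (0:ℝ), d = |condF F y x - F x|}
  have hbdd : BddAbove {d : ℝ | ∃ x ≥ (0:ℝ), ∃ y ≥ (0:ℝ), d = |condF F y x - F x|} := by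
    refine ⟨1, ?_⟩
    rintro _ ⟨x, hx, y, -, rfl⟩
    have h0 : 0 ≤ condF F y x :=
      div_nonneg (sub_nonneg.2 (hmono (by linarith))) (sub_nonneg.2 (hF1 y))
    have h1 : condF F y x ≤ 1 :=
      div_le_one_of_le₀ (sub_le_sub_right (hF1 _) _) (sub_nonneg.2 (hF1 y))
    rw [abs_le]
    constructor <;> linarith [hF0 x, hF1 x]
  have hGmul : ∀ x ≥ 0, ∀ y ≥ 0, |G (x + y) - G x * G y| ≤ δ * G y := by
    intro x hx y hy
    have hy0 : 0 ≤ G y := sub_nonneg.2 (hF1 y)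
    rcases hy0.eq_or_lt with h | h
    · have hle : G (x + y) ≤ G y := hGanti (by linarith)
      have hge : 0 ≤ G (x + y) := sub_nonneg.2 (hF1 _)
      rw [← h] at hle ⊢
      simp [le_antisymm hle hge]
    · have hle : |condF F y x - F x| ≤ δ := le_csSup hbdd ⟨x, hx, y, hy, rfl⟩
      have heq : G (x + y) - G x * G y = -((condF F y x - F x) * G y) := by
        have : condF F y x * G y = F (x + y) - F y := div_mul_cancel₀ _ h.ne'
        have hxy : G (x + y) = 1 - F (x + y) := rfl
        have hGx : G x = 1 - F x := rfl
        have hGy : G y = 1 - F y := rfl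
        linear_combination this + hxy - hGy - G y * hGx
      rw [heq, abs_neg, abs_mul, abs_of_pos h]
      gcongr
  have hfinal : sSup {d : ℝ | ∃ x ≥ (0:ℝ), d = |F x - (1 - Real.exp (-μ * x))|} ≤ 2 * δ := by
    refine csSup_le ⟨_, 0, le_rfl, rfl⟩ ?_
    rintro _ ⟨x, hx, rfl⟩
    have h := abs_sub_exp_le_of_abs_integral_sub_le hμ
      (fun x => hGanti.intervalIntegrable) hGanti.measurable.stronglyMeasurable hGcont
      (fun x hx => abs_integral_sub_le_of_almost_multiplicative hμ hGint hGmean hGmul hx) hx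
    rw [abs_sub_comm] at h
    rwa [sub_sub_eq_add_sub, add_comm, ← sub_sub_eq_add_sub]
  linarith
end

section
/- Let λ > 0 and let ξ₁, ξ₂ be nonnegative random variables with distribution functions Ξ₁, Ξ₂. Define nonnegative integer-valued random variables θ₁, θ₂ by Pr{θ_k = m} = ∫₀^∞ e^{−λx} (λx)^m / m! dΞ_k(x) for m = 0, 1, 2, … and k = 1, 2. Then ξ₁ ≤_{C_λ} ξ₂ if and only if θ₁ ≤_st θ₂. -/
open MeasureTheory Real Set

/-- The order relation `C_λ`: `Ξ₁ ≤_{C_λ} Ξ₂` iff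
`∫₀^∞ e^{-λx} x^i Ξ₁(x) dx ≥ ∫₀^∞ e^{-λx} x^i Ξ₂(x) dx` for every integer `i ≥ 0`. -/
def CLambdaLE (lam : ℝ) (Ξ₁ Ξ₂ : ℝ → ℝ) : Prop :=
  ∀ i : ℕ, ∫ x in Set.Ioi (0:ℝ), Real.exp (-lam * x) * x ^ i * Ξ₂ x ≤
    ∫ x in Set.Ioi (0:ℝ), Real.exp (-lam * x) * x ^ i * Ξ₁ x

open Filter Topology in
theorem tendsto_exp_neg_mul_poisson_sum {lam : ℝ} (hlam : 0 < lam) (i : ℕ) :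
    Tendsto (fun x : ℝ => -((i.factorial : ℝ) / lam ^ (i + 1) *
      ∑ k ∈ Finset.range (i + 1), Real.exp (-lam * x) * (lam * x) ^ k / k.factorial))
      atTop (𝓝 0) := by
  have hterm (k : ℕ) : Tendsto
      (fun x : ℝ => Real.exp (-lam * x) * (lam * x) ^ k / k.factorial) atTop (𝓝 0) := by
    have h := (Real.tendsto_pow_mul_exp_neg_atTop_nhds_zero k).comp
      (tendsto_id.const_mul_atTop hlam)
    simpa [Function.comp_def, mul_comm] using h.div_const (k.factorial : ℝ)
  simpa using ((tendsto_finsetSum (Finset.range (i + 1)) fun k _ => hterm k).const_mul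
    ((i.factorial : ℝ) / lam ^ (i + 1))).neg

theorem hasDerivAt_poisson_sum (lam : ℝ) (i : ℕ) (x : ℝ) :
    HasDerivAt (fun x : ℝ =>
      ∑ k ∈ Finset.range (i + 1), Real.exp (-lam * x) * (lam * x) ^ k / k.factorial)
      (-(Real.exp (-lam * x) * lam ^ (i + 1) * x ^ i / i.factorial)) x := by
  have hexp : HasDerivAt (fun x : ℝ => Real.exp (-lam * x)) (Real.exp (-lam * x) * -lam) x := by
    simpa using ((hasDerivAt_id x).const_mul (-lam)).exp
  induction i with
  | zero => simpa [mul_comm] using hexp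
  | succ i ih =>
    have hpow : HasDerivAt (fun x : ℝ => (lam * x) ^ (i + 1))
        ((i + 1 : ℕ) * (lam * x) ^ i * lam) x := by
      simpa using ((hasDerivAt_id x).const_mul lam).fun_pow (i + 1)
    have h := ih.add ((hexp.mul hpow).div_const ((i + 1).factorial : ℝ))
    simp_rw [Finset.sum_range_succ _ (i + 1)]
    refine h.congr_deriv ?_
    have hi : (i.factorial : ℝ) ≠ 0 := by positivity
    have hi' : (i : ℝ) + 1 ≠ 0 := by positivity
    push_cast [Nat.factorial_succ]
    field_simp
    ring

theorem hasDerivAt_exp_mul_pow_antideriv {lam : ℝ} (hlam : 0 < lam) (i : ℕ) (x : ℝ) :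
    HasDerivAt (fun x : ℝ => -((i.factorial : ℝ) / lam ^ (i + 1) *
      ∑ k ∈ Finset.range (i + 1), Real.exp (-lam * x) * (lam * x) ^ k / k.factorial))
      (Real.exp (-lam * x) * x ^ i) x := by
  refine ((hasDerivAt_poisson_sum lam i x).const_mul _).neg.congr_deriv ?_
  field_simp

theorem integrableOn_exp_neg_mul_pow {lam : ℝ} (hlam : 0 < lam) (i : ℕ) {y : ℝ} (hy : 0 ≤ y) :
    IntegrableOn (fun x : ℝ => Real.exp (-lam * x) * x ^ i) (Set.Ioi y) :=
  integrableOn_Ioi_deriv_of_nonneg' (fun x _ => hasDerivAt_exp_mul_pow_antideriv hlam i x)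
    (fun _ hx => mul_nonneg (Real.exp_pos _).le (pow_nonneg (hy.trans (le_of_lt hx)) _))
    (tendsto_exp_neg_mul_poisson_sum hlam i)

/-- The tail of the Gamma integral is a Poisson distribution function. -/
theorem integral_Ioi_exp_neg_mul_pow {lam : ℝ} (hlam : 0 < lam) (i : ℕ) {y : ℝ} (hy : 0 ≤ y) :
    ∫ x in Set.Ioi y, Real.exp (-lam * x) * x ^ i = (i.factorial : ℝ) / lam ^ (i + 1) *
      ∑ k ∈ Finset.range (i + 1), Real.exp (-lam * y) * (lam * y) ^ k / k.factorial := by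
  rw [integral_Ioi_of_hasDerivAt_of_tendsto'
    (fun x _ => hasDerivAt_exp_mul_pow_antideriv hlam i x)
    (integrableOn_exp_neg_mul_pow hlam i hy) (tendsto_exp_neg_mul_poisson_sum hlam i)]
  ring

theorem ae_nonneg_of_measure_Iio_zero {ν : Measure ℝ} (hν : ν (Set.Iio 0) = 0) :
    ∀ᵐ y ∂ν, 0 ≤ y := by
  simpa [ae_iff, Set.Iio] using hν

theorem integrable_poisson_weight {lam : ℝ} (hlam : 0 < lam) (ν : Measure ℝ)
    [IsProbabilityMeasure ν] (hν : ν (Set.Iio 0) = 0) (k : ℕ) :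
    Integrable (fun y => Real.exp (-lam * y) * (lam * y) ^ k / k.factorial) ν := by
  refine Integrable.of_bound (C := 1) (by fun_prop) ?_
  filter_upwards [ae_nonneg_of_measure_Iio_zero hν] with y hy
  have hly : 0 ≤ lam * y := by positivity
  rw [Real.norm_of_nonneg (by positivity), mul_div_assoc]
  calc Real.exp (-lam * y) * ((lam * y) ^ k / k.factorial)
      ≤ Real.exp (-lam * y) * Real.exp (lam * y) := by
        gcongr
        exact Real.pow_div_factorial_le_exp _ hly k
    _ = 1 := by simp [← Real.exp_add]

/-- Integrating a distribution function against a Gamma weight gives a mixed Poisson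
distribution function. -/
theorem integral_exp_mul_pow_mul_cdf {lam : ℝ} (hlam : 0 < lam) (ν : Measure ℝ)
    [IsProbabilityMeasure ν] (hν : ν (Set.Iio 0) = 0) (i : ℕ) :
    ∫ x in Set.Ioi (0:ℝ), Real.exp (-lam * x) * x ^ i * (ν (Set.Iic x)).toReal =
      (i.factorial : ℝ) / lam ^ (i + 1) * ∑ k ∈ Finset.range (i + 1),
        ∫ y, Real.exp (-lam * y) * (lam * y) ^ k / k.factorial ∂ν := by
  let g : ℝ → ℝ := fun x => Real.exp (-lam * x) * x ^ i
  let f : ℝ → ℝ → ℝ := fun x y => (Set.Ici y).indicator g x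
  have hf : Integrable (Function.uncurry f) ((volume.restrict (Set.Ioi (0:ℝ))).prod ν) := by
    have h : Integrable (fun p : ℝ × ℝ => g p.1)
        ((volume.restrict (Set.Ioi (0:ℝ))).prod ν) :=
      (integrableOn_exp_neg_mul_pow hlam i le_rfl).comp_fst ν
    exact h.indicator (measurableSet_le measurable_snd measurable_fst)
  have hinner (x : ℝ) : ∫ y, f x y ∂ν = g x * (ν (Set.Iic x)).toReal := by
    have h : f x = (Set.Iic x).indicator fun _ => g x := by
      ext y
      simp [f, Set.indicator_apply]
    rw [h, integral_indicator_const _ measurableSet_Iic, smul_eq_mul, mul_comm, Measure.real]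
  have houter : ∀ᵐ y ∂ν, ∫ x in Set.Ioi (0:ℝ), f x y = (i.factorial : ℝ) / lam ^ (i + 1) *
      ∑ k ∈ Finset.range (i + 1), Real.exp (-lam * y) * (lam * y) ^ k / k.factorial := by
    filter_upwards [ae_nonneg_of_measure_Iio_zero hν] with y hy
    rw [← integral_Ici_eq_integral_Ioi, setIntegral_indicator measurableSet_Ici,
      Set.inter_eq_self_of_subset_right (Set.Ici_subset_Ici.2 hy),
      integral_Ici_eq_integral_Ioi, integral_Ioi_exp_neg_mul_pow hlam i hy]
  calc _ = ∫ x in Set.Ioi (0:ℝ), ∫ y, f x y ∂ν := by simp_rw [hinner, g]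
    _ = ∫ y, (∫ x in Set.Ioi (0:ℝ), f x y) ∂ν := integral_integral_swap hf
    _ = _ := by
      rw [integral_congr_ae houter, integral_const_mul,
        integral_finsetSum _ fun k _ => integrable_poisson_weight hlam ν hν k]

theorem toReal_measure_lt_eq_one_sub_sum {Ω : Type*} [MeasurableSpace Ω] (P : Measure Ω)
    [IsProbabilityMeasure P] {θ : Ω → ℕ} (hθ : Measurable θ) (m : ℕ) :
    (P {ω | m < θ ω}).toReal =
      1 - ∑ k ∈ Finset.range (m + 1), (P {ω | θ ω = k}).toReal := by
  have hsum := sum_measureReal_preimage_singleton (μ := P) (f := θ) (Finset.range (m + 1))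
    fun k _ => hθ (measurableSet_singleton k)
  have hcompl : {ω | m < θ ω} = (θ ⁻¹' (Finset.range (m + 1) : Set ℕ))ᶜ := by
    ext ω
    simp
  change P.real _ = 1 - ∑ k ∈ Finset.range (m + 1), P.real (θ ⁻¹' {k})
  rw [hsum, hcompl, probReal_compl_eq_one_sub (hθ (Set.to_countable _).measurableSet)]

/-- **Lemma A1.**  Let `ξ₁, ξ₂` be nonnegative random variables with laws `ν₁, ν₂` and
distribution functions `Ξ₁, Ξ₂`, and let `θ₁, θ₂` be nonnegative integer-valued random
variables with `Pr{θ_k = m} = ∫₀^∞ e^{-λx} (λx)^m / m! dΞ_k(x)`.  Then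
`ξ₁ ≤_{C_λ} ξ₂` if and only if `θ₁ ≤_st θ₂`, i.e. `Pr{θ₁ > m} ≤ Pr{θ₂ > m}` for all `m`. -/
theorem cLambda_iff_stochastic_order
    (lam : ℝ) (hlam : 0 < lam)
    (ν₁ ν₂ : Measure ℝ) [IsProbabilityMeasure ν₁] [IsProbabilityMeasure ν₂]
    (hν₁ : ν₁ (Set.Iio 0) = 0) (hν₂ : ν₂ (Set.Iio 0) = 0)
    (Ξ₁ Ξ₂ : ℝ → ℝ)
    (hΞ₁ : ∀ x, Ξ₁ x = (ν₁ (Set.Iic x)).toReal)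
    (hΞ₂ : ∀ x, Ξ₂ x = (ν₂ (Set.Iic x)).toReal)
    {Ω₁ Ω₂ : Type*} [MeasurableSpace Ω₁] [MeasurableSpace Ω₂]
    (P₁ : Measure Ω₁) (P₂ : Measure Ω₂)
    [IsProbabilityMeasure P₁] [IsProbabilityMeasure P₂]
    (θ₁ : Ω₁ → ℕ) (θ₂ : Ω₂ → ℕ) (hθ₁m : Measurable θ₁) (hθ₂m : Measurable θ₂)
    (hθ₁ : ∀ m : ℕ, (P₁ {ω | θ₁ ω = m}).toReal =
      ∫ x, Real.exp (-lam * x) * (lam * x) ^ m / (Nat.factorial m) ∂ν₁)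
    (hθ₂ : ∀ m : ℕ, (P₂ {ω | θ₂ ω = m}).toReal =
      ∫ x, Real.exp (-lam * x) * (lam * x) ^ m / (Nat.factorial m) ∂ν₂) :
    CLambdaLE lam Ξ₁ Ξ₂ ↔
      ∀ m : ℕ, (P₁ {ω | m < θ₁ ω}).toReal ≤ (P₂ {ω | m < θ₂ ω}).toReal := by
  refine forall_congr' fun i => ?_
  simp_rw [hΞ₁, hΞ₂]
  rw [integral_exp_mul_pow_mul_cdf hlam ν₁ hν₁, integral_exp_mul_pow_mul_cdf hlam ν₂ hν₂,
    toReal_measure_lt_eq_one_sub_sum P₁ hθ₁m, toReal_measure_lt_eq_one_sub_sum P₂ hθ₂m]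
  simp_rw [hθ₁, hθ₂]
  rw [mul_le_mul_iff_right₀ (by positivity), sub_le_sub_iff_left]
end

section
/- Let λ > 0 and let Ξ be the distribution function of a nonnegative random variable. Then for every integer m ≥ 0, λ ∫₀^∞ e^{−λx} (λx)^m / m! · Ξ(x) dx = Σ_{i=0}^{m} ∫₀^∞ e^{−λx} (λx)^i / i! dΞ(x), where the right-hand side integrals are Lebesgue–Stieltjes integrals with respect to the probability measure determined by Ξ. -/
open MeasureTheory Real Set

/-- The Poisson weight `e^{-λx} (λx)^i / i!` tends to `0` as `x → ∞`. -/
lemma tendsto_poissonWeight_atTop {lam : ℝ} (hlam : 0 < lam) (i : ℕ) :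
    Filter.Tendsto (fun x : ℝ => Real.exp (-lam * x) * (lam * x) ^ i / (Nat.factorial i))
      Filter.atTop (nhds 0) := by
  have h := (Real.tendsto_pow_mul_exp_neg_atTop_nhds_zero i).comp
    (Filter.tendsto_id.const_mul_atTop hlam)
  have h' := h.div_const (Nat.factorial i : ℝ)
  rw [zero_div] at h'
  refine h'.congr fun x => ?_
  simp only [Function.comp_apply, id, neg_mul]
  ring

/-- The sum of Poisson weights telescopes under differentiation. -/
lemma hasDerivAt_sum_poissonWeight (lam : ℝ) (m : ℕ) (x : ℝ) :
    HasDerivAt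
      (fun x : ℝ => ∑ i ∈ Finset.range (m + 1),
        Real.exp (-lam * x) * (lam * x) ^ i / (Nat.factorial i))
      (-(lam * (Real.exp (-lam * x) * (lam * x) ^ m / (Nat.factorial m)))) x := by
  have hl : HasDerivAt (fun x : ℝ => lam * x) lam x := by
    simpa using (hasDerivAt_id x).const_mul lam
  have he : HasDerivAt (fun x : ℝ => Real.exp (-lam * x)) (Real.exp (-lam * x) * -lam) x := by
    simpa using ((hasDerivAt_id x).const_mul (-lam)).exp
  induction m with
  | zero =>
    simp only [zero_add, Finset.range_one, Finset.sum_singleton, pow_zero, mul_one,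
      Nat.factorial_zero, Nat.cast_one, div_one]
    exact he.congr_deriv (by ring)
  | succ m ih =>
    simp only [Finset.sum_range_succ _ (m + 1)]
    refine (ih.add ((he.mul (hl.pow (m + 1))).div_const _)).congr_deriv ?_
    have hm : (Nat.factorial m : ℝ) ≠ 0 := by positivity
    simp only [Nat.factorial_succ, Nat.cast_mul, Nat.cast_add, Nat.cast_one,
      Nat.add_sub_cancel, Pi.pow_apply]
    have hm' : (m : ℝ) + 1 ≠ 0 := by positivity
    field_simp
    ring

lemma poissonWeight_nonneg {lam x : ℝ} (hlam : 0 ≤ lam) (hx : 0 ≤ x) (i : ℕ) :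
    0 ≤ Real.exp (-lam * x) * (lam * x) ^ i / (Nat.factorial i) := by
  positivity

lemma poissonWeight_le_one {lam x : ℝ} (hlam : 0 ≤ lam) (hx : 0 ≤ x) (i : ℕ) :
    Real.exp (-lam * x) * (lam * x) ^ i / (Nat.factorial i) ≤ 1 := by
  have h := Real.pow_div_factorial_le_exp (lam * x) (by positivity) i
  calc Real.exp (-lam * x) * (lam * x) ^ i / (Nat.factorial i)
      = Real.exp (-lam * x) * ((lam * x) ^ i / (Nat.factorial i)) := by ring
    _ ≤ Real.exp (-lam * x) * Real.exp (lam * x) := by gcongr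
    _ = 1 := by rw [← Real.exp_add]; simp

lemma tendsto_sum_poissonWeight_atTop {lam : ℝ} (hlam : 0 < lam) (m : ℕ) :
    Filter.Tendsto (fun x : ℝ => ∑ i ∈ Finset.range (m + 1),
      Real.exp (-lam * x) * (lam * x) ^ i / (Nat.factorial i)) Filter.atTop (nhds 0) := by
  simpa using tendsto_finsetSum (Finset.range (m + 1))
    fun i _ => tendsto_poissonWeight_atTop hlam i

lemma integrableOn_poissonWeight {lam : ℝ} (hlam : 0 < lam) (m : ℕ) :
    IntegrableOn (fun x : ℝ => lam * (Real.exp (-lam * x) * (lam * x) ^ m / (Nat.factorial m)))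
      (Ioi 0) := by
  have h := integrableOn_Ioi_deriv_of_nonpos' (a := 0)
    (fun x _ => hasDerivAt_sum_poissonWeight lam m x)
    (fun x hx => neg_nonpos.2
      (mul_nonneg hlam.le (poissonWeight_nonneg hlam.le (le_of_lt hx) m)))
    (tendsto_sum_poissonWeight_atTop hlam m)
  simpa using h.neg

/-- The tail integral of the Erlang density is a Poisson partial sum. -/
lemma setIntegral_Ioi_poissonWeight {lam t : ℝ} (hlam : 0 < lam) (ht : 0 ≤ t) (m : ℕ) :
    ∫ x in Ioi t, lam * (Real.exp (-lam * x) * (lam * x) ^ m / (Nat.factorial m)) =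
      ∑ i ∈ Finset.range (m + 1),
        Real.exp (-lam * t) * (lam * t) ^ i / (Nat.factorial i) := by
  have h := integral_Ioi_of_hasDerivAt_of_nonpos' (a := t)
    (fun x _ => hasDerivAt_sum_poissonWeight lam m x)
    (fun x hx => neg_nonpos.2
      (mul_nonneg hlam.le (poissonWeight_nonneg hlam.le (ht.trans (le_of_lt hx)) m)))
    (tendsto_sum_poissonWeight_atTop hlam m)
  rw [integral_neg, zero_sub] at h
  exact neg_injective h

lemma ae_nonneg_of_measure_Iio_eq_zero {ν : Measure ℝ} (hν : ν (Iio 0) = 0) :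
    ∀ᵐ t ∂ν, 0 ≤ t := by
  simp only [ae_iff, not_le]
  exact hν

/-- Integrating a density against a distribution function is integrating its tail integral
against the law. -/
lemma setIntegral_Ioi_mul_measureReal_Iic (ν : Measure ℝ) [IsProbabilityMeasure ν]
    (hν : ν (Iio 0) = 0) {g : ℝ → ℝ} (hg : IntegrableOn g (Ioi 0)) :
    ∫ x in Ioi (0 : ℝ), g x * (ν (Iic x)).toReal = ∫ t, (∫ x in Ioi t, g x) ∂ν := by
  have hmeas : MeasurableSet {z : ℝ × ℝ | z.2 ≤ z.1} :=
    measurableSet_le measurable_snd measurable_fst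
  have hint : Integrable ({z : ℝ × ℝ | z.2 ≤ z.1}.indicator fun z => g z.1)
      ((volume.restrict (Ioi (0 : ℝ))).prod ν) :=
    (Integrable.comp_fst hg ν).indicator hmeas
  have hae : ∀ᵐ t ∂ν, 0 ≤ t := ae_nonneg_of_measure_Iio_eq_zero hν
  have hswap := integral_integral_swap
    (f := fun x t => {z : ℝ × ℝ | z.2 ≤ z.1}.indicator (fun z => g z.1) (x, t)) hint
  calc ∫ x in Ioi (0 : ℝ), g x * (ν (Iic x)).toReal
      = ∫ x in Ioi (0 : ℝ), ∫ t, {z : ℝ × ℝ | z.2 ≤ z.1}.indicator (fun z => g z.1) (x, t) ∂ν := by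
        congr 1 with x
        have : (fun t => {z : ℝ × ℝ | z.2 ≤ z.1}.indicator (fun z => g z.1) (x, t)) =
            (Iic x).indicator fun _ => g x := by
          ext t; simp [indicator]
        rw [this, integral_indicator_const _ measurableSet_Iic, smul_eq_mul, mul_comm]
        rfl
    _ = ∫ t, (∫ x in Ioi (0 : ℝ),
          {z : ℝ × ℝ | z.2 ≤ z.1}.indicator (fun z => g z.1) (x, t)) ∂ν := hswap
    _ = ∫ t, (∫ x in Ioi t, g x) ∂ν := by
        refine integral_congr_ae (hae.mono fun t ht => ?_)
        have : (fun x => {z : ℝ × ℝ | z.2 ≤ z.1}.indicator (fun z => g z.1) (x, t)) =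
            (Ici t).indicator g := by
          ext x; simp [indicator]
        simp only [this]
        rw [← integral_Ici_eq_integral_Ioi, ← integral_Ici_eq_integral_Ioi,
          setIntegral_indicator measurableSet_Ici,
          inter_eq_right.2 (Ici_subset_Ici.2 ht)]

/-- For a nonnegative random variable with law `ν` and distribution function `Ξ`,
`λ ∫₀^∞ e^{-λx} (λx)^m / m! · Ξ(x) dx = Σ_{i=0}^{m} ∫₀^∞ e^{-λx} (λx)^i / i! dΞ(x)`,
where the right-hand integrals are with respect to the probability measure `ν`
determined by `Ξ`. -/
theorem integration_by_parts_identity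
    (lam : ℝ) (hlam : 0 < lam)
    (ν : Measure ℝ) [IsProbabilityMeasure ν] (hν : ν (Set.Iio 0) = 0)
    (Ξ : ℝ → ℝ) (hΞ : ∀ x, Ξ x = (ν (Set.Iic x)).toReal) (m : ℕ) :
    lam * ∫ x in Set.Ioi (0:ℝ),
        Real.exp (-lam * x) * (lam * x) ^ m / (Nat.factorial m) * Ξ x =
      ∑ i ∈ Finset.range (m + 1),
        ∫ x, Real.exp (-lam * x) * (lam * x) ^ i / (Nat.factorial i) ∂ν := by
  have hae : ∀ᵐ t ∂ν, 0 ≤ t := ae_nonneg_of_measure_Iio_eq_zero hν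
  have hint : ∀ i : ℕ, Integrable
      (fun x : ℝ => Real.exp (-lam * x) * (lam * x) ^ i / (Nat.factorial i)) ν := fun i =>
    Integrable.of_bound (by fun_prop) 1 (hae.mono fun x hx => by
      rw [Real.norm_of_nonneg (poissonWeight_nonneg hlam.le hx i)]
      exact poissonWeight_le_one hlam.le hx i)
  rw [← integral_finsetSum _ fun i _ => hint i, ← integral_const_mul]
  simp only [hΞ, ← mul_assoc lam]
  have h := setIntegral_Ioi_mul_measureReal_Iic ν hν (integrableOn_poissonWeight hlam m)
  refine Eq.trans ?_ (h.trans (integral_congr_ae (hae.mono fun t ht =>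
    setIntegral_Ioi_poissonWeight hlam ht m)))
  rfl
end

section
/- Let F be the distribution function of a nonnegative random variable with mean 1/μ (μ > 0), set h(x,y) = F(x) − F_y(x) and Θ(x) = μ ∫₀^∞ F̄(y)·h(x,y) dy. Then for every x ≥ 0, F̄(x) = e^{−μx} + μ ∫₀^x e^{−μ(x−t)} Θ(t) dt − Θ(x), where F̄ = 1 − F. -/
open MeasureTheory Real Set

/-- The integral over `(0, ∞)` of a shifted integrable function. -/
theorem integral_Ioi_zero_comp_add_left {G : ℝ → ℝ} (hG : IntegrableOn G (Ioi 0)) {x : ℝ}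
    (hx : 0 ≤ x) :
    ∫ y in Ioi (0:ℝ), G (x + y) = (∫ y in Ioi (0:ℝ), G y) - ∫ y in (0:ℝ)..x, G y := by
  have h1 : ∫ y in Ioi (0:ℝ), G (x + y) = ∫ y in Ioi x, G y := by
    simpa using (measurePreserving_add_left volume x).setIntegral_preimage_emb
      (measurableEmbedding_addLeft x) G (Ioi x)
  have h2 := intervalIntegral.integral_Ioi_sub_Ioi hG hx
  rw [h1]
  linarith

/-- Variation of constants for the primitive of an antitone function. -/
theorem one_sub_mul_integral_eq {G : ℝ → ℝ} (hG : Antitone G) (μ : ℝ) {x : ℝ} (hx : 0 ≤ x) :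
    1 - μ * ∫ s in (0:ℝ)..x, G s =
      exp (-μ * x) + μ * ∫ t in (0:ℝ)..x,
        exp (-μ * (x - t)) * (1 - μ * (∫ s in (0:ℝ)..t, G s) - G t) := by
  have hint : ∀ a b, IntervalIntegrable G volume a b := fun a b => hG.intervalIntegrable
  have hI : Continuous fun t => ∫ s in (0:ℝ)..t, G s :=
    intervalIntegral.continuous_primitive hint 0
  have key := integral_eq_of_hasDerivAt_off_countable_of_le
    (fun t => exp (-μ * (x - t)) * (1 - μ * ∫ s in (0:ℝ)..t, G s))
    (fun t => μ * (exp (-μ * (x - t)) * (1 - μ * (∫ s in (0:ℝ)..t, G s) - G t)))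
    hx hG.countable_not_continuousAt (by fun_prop) ?_ ?_
  · rw [intervalIntegral.integral_const_mul] at key
    simp at key ⊢
    linarith
  · intro t ht
    have hc : ContinuousAt G t := by simpa using ht.2
    have h1 : HasDerivAt (fun u => ∫ s in (0:ℝ)..u, G s) (G t) t :=
      intervalIntegral.integral_hasDerivAt_right (hint 0 t)
        (hG.measurable.stronglyMeasurable.stronglyMeasurableAtFilter) hc
    have h2 : HasDerivAt (fun u => exp (-μ * (x - u))) (exp (-μ * (x - t)) * (-μ * -1)) t :=
      (((hasDerivAt_id t).const_sub x).const_mul (-μ)).exp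
    exact (h2.mul ((h1.const_mul μ).const_sub 1)).congr_deriv (by ring)
  · refine IntervalIntegrable.const_mul ?_ μ
    refine IntervalIntegrable.continuousOn_mul ?_ (by fun_prop)
    exact (Continuous.intervalIntegrable (by fun_prop) _ _).sub (hint 0 x)

/-- For a nonnegative random variable (with law `ν`) with distribution function `F` and
mean `∫₀^∞ F̄(y) dy = 1/μ`, setting `h(x,y) = F(x) - F_y(x)` and
`Θ(x) = μ ∫₀^∞ F̄(y) h(x,y) dy`, we have for every `x ≥ 0`:
`F̄(x) = e^{-μx} + μ ∫₀^x e^{-μ(x-t)} Θ(t) dt - Θ(x)`. -/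
theorem tail_solution_formula
    (μ : ℝ) (hμ : 0 < μ)
    (ν : Measure ℝ) [IsProbabilityMeasure ν] (hν : ν (Set.Iio 0) = 0)
    (F : ℝ → ℝ) (hF : ∀ x, F x = (ν (Set.Iic x)).toReal)
    (hmean : ∫ y in Set.Ioi (0:ℝ), (1 - F y) = 1 / μ)
    (Θ : ℝ → ℝ)
    (hΘ : ∀ x, Θ x = μ * ∫ y in Set.Ioi (0:ℝ), (1 - F y) * (F x - condF F y x)) :
    ∀ x ≥ (0:ℝ),
      1 - F x =
        Real.exp (-μ * x) +
          μ * (∫ t in (0:ℝ)..x, Real.exp (-μ * (x - t)) * Θ t) - Θ x := by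
  intro x hx
  have hle : ∀ y, F y ≤ 1 := fun y => by rw [hF]; exact measureReal_le_one
  have hmono : Monotone F := fun a b hab => by
    rw [hF, hF]
    exact measureReal_mono (Iic_subset_Iic.2 hab)
  have hanti : Antitone fun y => 1 - F y := fun a b hab => sub_le_sub_left (hmono hab) 1
  have hint : IntegrableOn (fun y => 1 - F y) (Ioi 0) :=
    Integrable.of_integral_ne_zero (by rw [hmean]; positivity)
  have hΘ' : ∀ t, 0 ≤ t → Θ t = 1 - μ * (∫ s in (0:ℝ)..t, (1 - F s)) - (1 - F t) := by
    intro t ht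
    have hpt : ∀ y, (1 - F y) * (F t - condF F y t) = (1 - F (t + y)) - (1 - F t) * (1 - F y) := by
      intro y
      rw [condF]
      by_cases hy : 1 - F y = 0
      · have hty : F (t + y) = 1 :=
          le_antisymm (hle _) (by linarith [hmono (show y ≤ t + y by linarith)])
        simp [hy, hty]
      · field_simp
        ring
    have hshift : IntegrableOn (fun y => 1 - F (t + y)) (Ioi 0) := by
      refine Integrable.mono' hint
        (hanti.comp_monotone (monotone_id.const_add t)).measurable.aestronglyMeasurable ?_
      refine Filter.Eventually.of_forall fun y => ?_
      rw [norm_of_nonneg (sub_nonneg.2 (hle _))]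
      exact hanti (by linarith)
    simp_rw [hΘ, hpt]
    rw [integral_sub hshift (hint.const_mul _), integral_const_mul,
      integral_Ioi_zero_comp_add_left hint ht, hmean]
    field_simp
  have hcongr : ∫ t in (0:ℝ)..x, exp (-μ * (x - t)) * Θ t = ∫ t in (0:ℝ)..x,
      exp (-μ * (x - t)) * (1 - μ * (∫ s in (0:ℝ)..t, (1 - F s)) - (1 - F t)) := by
    refine intervalIntegral.integral_congr fun t ht => ?_
    rw [uIcc_of_le hx] at ht
    simp only [hΘ' t ht.1]
  rw [hcongr, hΘ' x hx]
  linarith [one_sub_mul_integral_eq hanti μ hx]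
end
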